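/- Let s ≥ 1, let u = (u₁,…,u_s) ∈ ℕ^s, and let f : [0,1]^s → ℝ be a function whose mixed partial derivatives up to order u_i in each variable x_i are continuous on [0,1]^s. Let k ∈ ℕ₀^s with k_i = ∑_{j=1}^{N_i} 2^{a_{i,j}}, a_{i,1} > ⋯ > a_{i,N_i} ≥ 0, and set k_{i,≤}^{u_i} = ∑_{j ≤ u_i} 2^{a_{i,j}} and k_{i,>}^{u_i} = ∑_{j > u_i} 2^{a_{i,j}} (sums over existing digits, equal to 0 when empty). Then f̂(k) = (−1)^{∑_{i=1}^s min(u_i,N_i)} · 2^{−μ'_u(k)} · ∫_{[0,1)^s} f^{(min(u,N_k))}(x) · ∏_{i=1}^s W(k_{i,≤}^{u_i})(x_i) · wal_{(k_{1,>}^{u₁},…,k_{s,>}^{u_s})}(x) dx, where f^{(min(u,N_k))} denotes the mixed partial derivative of f of order min(u_i, N_i) in each variable x_i. -/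

import Mathlib

open MeasureTheory Finset
open scoped ENNReal

noncomputable section

/-- The `j`-th binary digit (`j ≥ 1`) of a real number `x ∈ [0,1)`
(using the binary expansion in which infinitely many digits are `0`). -/
def bdigit (x : ℝ) (j : ℕ) : ℕ := ⌊x * 2 ^ j⌋.toNat % 2

/-- The `k`-th (dyadic) Walsh function. -/
def walsh (k : ℕ) (x : ℝ) : ℝ :=
  (-1 : ℝ) ^ (∑ j ∈ Finset.range k, if k.testBit j then bdigit x (j + 1) else 0)

/-- The multi-dimensional Walsh function. -/
def walshV {s : ℕ} (k : Fin s → ℕ) (x : Fin s → ℝ) : ℝ := ∏ i, walsh (k i) (x i)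

/-- The half-open unit cube `[0,1)^s`. -/
def unitCube (s : ℕ) : Set (Fin s → ℝ) := Set.univ.pi fun _ => Set.Ico (0 : ℝ) 1

/-- The closed unit cube `[0,1]^s`. -/
def closedCube (s : ℕ) : Set (Fin s → ℝ) := Set.univ.pi fun _ => Set.Icc (0 : ℝ) 1

/-- The `k`-th Walsh coefficient of `f`. -/
def walshCoeff {s : ℕ} (f : (Fin s → ℝ) → ℝ) (k : Fin s → ℕ) : ℝ :=
  ∫ x in unitCube s, f x * walshV k x

/-- `z ⊕ 2^{-n}` : flipping the `n`-th binary digit of `z`. -/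
def oplus (z : ℝ) (n : ℕ) : ℝ := z + (-1) ^ bdigit z n * ((2 : ℝ) ^ n)⁻¹

/-- The dyadic difference `∂_{i,n}`. -/
def dyadicDiff {s : ℕ} (i : Fin s) (n : ℕ) (g : (Fin s → ℝ) → ℝ) (x : Fin s → ℝ) : ℝ :=
  2 ^ n * (g (Function.update x i (oplus (x i) n)) - g x)

/-- The function `χ_n`. -/
def chi (n : ℕ) (x y : ℝ) : ℝ :=
  if min x (oplus x n) ≤ y ∧ y ≤ max x (oplus x n) then 2 ^ n else 0

/-- The exponents in the binary expansion of `k`, in decreasing order. -/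
def bitsDesc (k : ℕ) : List ℕ := ((List.range k).filter fun j => k.testBit j).reverse

/-- The number `N` of nonzero binary digits of `k`. -/
def numBits (k : ℕ) : ℕ := (bitsDesc k).length

/-- The weight `μ'_u(k) = ∑_{j=1}^{min(u,N)} (a_j + 2)` for scalar `k`. -/
def muW (u k : ℕ) : ℕ := (((bitsDesc k).take u).map (· + 2)).sum

/-- The weight `μ'_u(k)` for vectors. -/
def muWV {s : ℕ} (u k : Fin s → ℕ) : ℕ := ∑ i, muW (u i) (k i)

/-- `k_{≤}^{u}` : the `u` most significant binary digits of `k`. -/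
def kLe (u k : ℕ) : ℕ := (((bitsDesc k).take u).map (2 ^ ·)).sum

/-- `k_{>}^{u}` : the remaining binary digits of `k`. -/
def kGt (u k : ℕ) : ℕ := (((bitsDesc k).drop u).map (2 ^ ·)).sum

/-- The functions `W(k)`, defined inductively by stripping the least significant
binary digit of `k` (whose exponent is the 2-adic valuation of `k`). -/
def Wfun : ℕ → ℝ → ℝ
  | 0 => fun _ => 1
  | (k + 1) => fun y =>
      ∫ x in Set.Ico (0 : ℝ) 1,
        chi ((k + 1).factorization 2 + 1) x y *
          Wfun ((k + 1) - 2 ^ ((k + 1).factorization 2)) x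
  decreasing_by exact Nat.sub_lt (Nat.succ_pos k) (Nat.two_pow_pos _)

/-- Composition of the dyadic differences `∂_{i,a+1}` for `a` running over a list. -/
def dCompCoord {s : ℕ} (i : Fin s) (L : List ℕ) (g : (Fin s → ℝ) → ℝ) : (Fin s → ℝ) → ℝ :=
  L.foldr (fun a h => dyadicDiff i (a + 1) h) g

/-- The operator `d_{k_u}` : composition over all coordinates `i` of the dyadic
differences `∂_{i,a_{i,j}+1}`, `1 ≤ j ≤ min(u_i, N_i)`. -/
def dComp {s : ℕ} (u k : Fin s → ℕ) (f : (Fin s → ℝ) → ℝ) : (Fin s → ℝ) → ℝ :=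
  (List.finRange s).foldr (fun i g => dCompCoord i ((bitsDesc (k i)).take (u i)) g) f

/-- The multi-index `ν` increased by one in coordinate `i`. -/
def addE {s : ℕ} (i : Fin s) (ν : Fin s → ℕ) : Fin s → ℕ := Function.update ν i (ν i + 1)

/-- `D` is a family of mixed partial derivatives of `f`, of orders up to `u_i` in
the variable `x_i`, each continuous on the closed cube `[0,1]^s`. -/
def HasMixedDerivs {s : ℕ} (u : Fin s → ℕ) (f : (Fin s → ℝ) → ℝ)
    (D : (Fin s → ℕ) → (Fin s → ℝ) → ℝ) : Prop :=
  D (fun _ => 0) = f ∧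
    (∀ ν : Fin s → ℕ, (∀ j, ν j ≤ u j) → ContinuousOn (D ν) (closedCube s)) ∧
    ∀ (ν : Fin s → ℕ) (i : Fin s), (∀ j, addE i ν j ≤ u j) →
      ∀ x ∈ closedCube s,
        HasDerivWithinAt (fun t => D ν (Function.update x i t)) (D (addE i ν) x)
          (Set.Icc 0 1) (x i)

/-- `∫_{[0,1)^{s-|v|}} F dx_{S∖v}` : the inner integral over the coordinates outside `v`
(as a function of the coordinates in `v`). -/
def projInt {s : ℕ} (v : Finset (Fin s)) (F : (Fin s → ℝ) → ℝ) (x : Fin s → ℝ) : ℝ :=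
  ∫ y in unitCube s, F fun i => if i ∈ v then x i else y i

/-- The mixed norm `‖F^{(·)}‖_p` : the `L^p` norm (over the coordinates in `v`) of the
integral of `F` over the coordinates outside `v`. -/
def mixedNorm {s : ℕ} (p : ℝ≥0∞) (v : Finset (Fin s)) (F : (Fin s → ℝ) → ℝ) : ℝ≥0∞ :=
  eLpNorm (projInt v F) p (volume.restrict (unitCube s))

/-- The `ℓ^q` norm of a finite family in `ℝ≥0∞`, with the usual modification at `q = ∞`. -/
def lqNorm {ι : Type*} [Fintype ι] (q : ℝ≥0∞) (a : ι → ℝ≥0∞) : ℝ≥0∞ :=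
  if q = ∞ then ⨆ i, a i else (∑ i, a i ^ q.toReal) ^ q.toReal⁻¹

/-- The `h`-th point of the digital net generated by the matrices `C i`. -/
def netPoint {s m n : ℕ} (C : Fin s → Matrix (Fin n) (Fin m) (ZMod 2)) (h : Fin (2 ^ m)) :
    Fin s → ℝ :=
  fun i => ∑ j : Fin n,
    (((∑ l : Fin m, (if (h : ℕ).testBit (l : ℕ) then (1 : ZMod 2) else 0) * C i j l).val : ℝ) *
      ((2 : ℝ) ^ ((j : ℕ) + 1))⁻¹)

/-- Membership of `k ∈ ℕ₀^s` in the dual net `P^⊥`. -/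
def inDual {s m n : ℕ} (C : Fin s → Matrix (Fin n) (Fin m) (ZMod 2)) (k : Fin s → ℕ) : Prop :=
  ∀ l : Fin m, ∑ i, ∑ j : Fin n, C i j l * (if (k i).testBit (j : ℕ) then (1 : ZMod 2) else 0) = 0

open Classical in
/-- `∑_{k_v ∈ P_v^⊥} 2^{-μ'_α(k_v)}`, encoded as a sum over all `k ∈ ℕ₀^s`
with support exactly `v` lying in the dual net. -/
def dualSum {s m n : ℕ} (α : ℕ) (C : Fin s → Matrix (Fin n) (Fin m) (ZMod 2))
    (v : Finset (Fin s)) : ℝ≥0∞ :=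
  ∑' k : Fin s → ℕ,
    if (∀ i, i ∈ v ↔ k i ≠ 0) ∧ inDual C k
    then (2 : ℝ≥0∞) ^ (-(muWV (fun _ => α) k : ℝ)) else 0

/-! ### Binary digits and Walsh functions -/

lemma bdigit_succ {x : ℝ} (hx : 0 ≤ x) (a : ℕ) :
    bdigit x (a + 1) = if Int.fract (x * 2 ^ a) < 1 / 2 then 0 else 1 := by
  have hz : (0 : ℝ) ≤ x * 2 ^ a := by positivity
  have hq : 0 ≤ ⌊x * 2 ^ a⌋ := Int.floor_nonneg.2 hz
  have hfr := Int.floor_add_fract (x * 2 ^ a)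
  have h0 := Int.fract_nonneg (x * 2 ^ a)
  have h1 := Int.fract_lt_one (x * 2 ^ a)
  unfold bdigit
  split_ifs with h
  · have : ⌊x * 2 ^ (a + 1)⌋ = 2 * ⌊x * 2 ^ a⌋ := by
      rw [Int.floor_eq_iff]
      push_cast
      constructor <;> rw [pow_succ] <;> linarith
    rw [this]
    omega
  · have : ⌊x * 2 ^ (a + 1)⌋ = 2 * ⌊x * 2 ^ a⌋ + 1 := by
      rw [Int.floor_eq_iff]
      push_cast
      constructor <;> rw [pow_succ] <;> linarith
    rw [this]
    omega

lemma measurable_bdigit (j : ℕ) : Measurable fun x => bdigit x j := by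
  have h : Measurable fun x : ℝ => ⌊x * 2 ^ j⌋ := Int.measurable_floor.comp (by fun_prop)
  exact (measurable_from_top (f := fun z : ℤ => z.toNat % 2)).comp h

lemma measurable_neg_one_pow_bdigit (j : ℕ) : Measurable fun x => (-1 : ℝ) ^ bdigit x j :=
  (measurable_from_top (f := fun m : ℕ => (-1 : ℝ) ^ m)).comp (measurable_bdigit j)

lemma bdigit_congr {x y : ℝ} {a j : ℕ} (hj : j ≤ a) (h : ⌊x * 2 ^ a⌋ = ⌊y * 2 ^ a⌋) :
    bdigit x j = bdigit y j := by
  have key (z : ℝ) : ⌊z * 2 ^ j⌋ = ⌊z * 2 ^ a⌋ / ((2 ^ (a - j) : ℕ) : ℤ) := by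
    rw [← Int.floor_div_natCast]
    congr 1
    rw [eq_div_iff (by positivity)]
    push_cast
    rw [mul_assoc, ← pow_add, Nat.add_sub_cancel' hj]
  rw [bdigit, bdigit, key x, key y, h]

lemma walsh_eq_of_lt {k M : ℕ} (h : k < 2 ^ M) (x : ℝ) :
    walsh k x = (-1 : ℝ) ^ (∑ j ∈ range M, if k.testBit j then bdigit x (j + 1) else 0) := by
  have extend {A B : ℕ} (hAB : A ≤ B) (hk : k < 2 ^ A) :
      (∑ j ∈ range A, if k.testBit j then bdigit x (j + 1) else 0)
        = ∑ j ∈ range B, if k.testBit j then bdigit x (j + 1) else 0 := by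
    refine Finset.sum_subset (Finset.range_mono hAB) fun j _ hj => ?_
    rw [Nat.testBit_lt_two_pow
      (hk.trans_le (Nat.pow_le_pow_right two_pos (by simpa using hj)))]
    simp
  unfold walsh
  rcases le_total k M with hkM | hkM
  · rw [extend hkM Nat.lt_two_pow_self]
  · rw [extend hkM h]

lemma walsh_two_pow_add {a r : ℕ} (hr : r < 2 ^ a) (x : ℝ) :
    walsh (2 ^ a + r) x = (-1) ^ bdigit x (a + 1) * walsh r x := by
  rw [walsh_eq_of_lt (M := a + 1) (by rw [pow_succ]; omega), walsh_eq_of_lt hr,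
    Finset.sum_range_succ, Nat.testBit_two_pow_add_eq, Nat.testBit_lt_two_pow hr]
  simp only [Bool.not_false, if_true, pow_add]
  rw [mul_comm]
  congr 2
  refine Finset.sum_congr rfl fun j hj => ?_
  rw [Nat.testBit_two_pow_add_gt (Finset.mem_range.1 hj)]

lemma walsh_congr {a r : ℕ} (hr : r < 2 ^ a) {x y : ℝ} (h : ⌊x * 2 ^ a⌋ = ⌊y * 2 ^ a⌋) :
    walsh r x = walsh r y := by
  rw [walsh_eq_of_lt hr, walsh_eq_of_lt hr]
  congr 1
  refine Finset.sum_congr rfl fun j hj => ?_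
  rw [bdigit_congr (Finset.mem_range.1 hj) h]

lemma measurable_walsh (k : ℕ) : Measurable (walsh k) := by
  have h : Measurable fun x => ∑ j ∈ range k, if k.testBit j then bdigit x (j + 1) else 0 := by
    refine Finset.measurable_sum _ fun j _ => ?_
    split_ifs
    · exact measurable_bdigit _
    · exact measurable_const
  exact (measurable_from_top (f := fun m : ℕ => (-1 : ℝ) ^ m)).comp h

lemma abs_walsh (k : ℕ) (x : ℝ) : |walsh k x| = 1 := by
  simp [walsh, abs_pow]

/-! ### Splitting off one binary digit of `k` -/

lemma pairwise_bitsDesc (k : ℕ) : (bitsDesc k).Pairwise (· > ·) := by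
  rw [bitsDesc, List.pairwise_reverse]
  exact List.pairwise_lt_range.filter _

lemma sum_two_pow_lt {L : List ℕ} (hL : L.Pairwise (· > ·)) {a : ℕ} (ha : ∀ b ∈ L, b < a) :
    (L.map (2 ^ ·)).sum < 2 ^ a := by
  induction L generalizing a with
  | nil => simp
  | cons b L ih =>
    rw [List.pairwise_cons] at hL
    have h1 := ih hL.2 hL.1
    have h2 : 2 ^ (b + 1) ≤ 2 ^ a := Nat.pow_le_pow_right two_pos (ha b (by simp))
    simp only [List.map_cons, List.sum_cons]
    rw [pow_succ] at h2
    omega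

lemma kGt_zero (k : ℕ) : kGt 0 k = k := by
  have key (n : ℕ) :
      (((List.range n).filter fun j => k.testBit j).map (2 ^ ·)).sum = k % 2 ^ n := by
    induction n with
    | zero => simp [Nat.mod_one]
    | succ n ih =>
      rw [List.range_succ, List.filter_append, List.map_append, List.sum_append, ih,
        Nat.mod_pow_succ]
      rcases Nat.mod_two_eq_zero_or_one (k / 2 ^ n) with h | h <;>
        simp [h, Nat.testBit_eq_decide_div_mod_eq]
  rw [kGt, bitsDesc, List.drop_zero, List.map_reverse, List.sum_reverse, key,
    Nat.mod_eq_of_lt Nat.lt_two_pow_self]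

lemma kLe_zero (k : ℕ) : kLe 0 k = 0 := by simp [kLe]

lemma muW_zero (k : ℕ) : muW 0 k = 0 := by simp [muW]

lemma muW_succ {j k : ℕ} (h : j < (bitsDesc k).length) :
    muW (j + 1) k = muW j k + ((bitsDesc k)[j] + 2) := by
  rw [muW, muW, ← List.take_append_getElem h, List.map_append, List.sum_append]
  simp only [List.map_cons, List.map_nil, List.sum_cons, List.sum_nil, add_zero]

lemma kLe_succ {j k : ℕ} (h : j < (bitsDesc k).length) :
    kLe (j + 1) k = kLe j k + 2 ^ (bitsDesc k)[j] := by
  rw [kLe, kLe, ← List.take_append_getElem h, List.map_append, List.sum_append]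
  simp only [List.map_cons, List.map_nil, List.sum_cons, List.sum_nil, add_zero]

lemma kGt_eq {j k : ℕ} (h : j < (bitsDesc k).length) :
    kGt j k = 2 ^ (bitsDesc k)[j] + kGt (j + 1) k := by
  rw [kGt, kGt, List.drop_eq_getElem_cons h, List.map_cons, List.sum_cons]

lemma kGt_succ_lt {j k : ℕ} (h : j < (bitsDesc k).length) :
    kGt (j + 1) k < 2 ^ (bitsDesc k)[j] := by
  have hp := (pairwise_bitsDesc k).sublist (List.drop_sublist j _)
  rw [List.drop_eq_getElem_cons h, List.pairwise_cons] at hp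
  exact sum_two_pow_lt hp.2 hp.1

lemma two_pow_succ_dvd_kLe {j k : ℕ} (h : j < (bitsDesc k).length) :
    2 ^ ((bitsDesc k)[j] + 1) ∣ kLe j k := by
  have hp := (pairwise_bitsDesc k).sublist (List.take_sublist (j + 1) _)
  rw [← List.take_append_getElem h, List.pairwise_append] at hp
  refine List.dvd_sum fun x hx => ?_
  obtain ⟨b, hb, rfl⟩ := List.mem_map.1 hx
  exact pow_dvd_pow 2 (hp.2.2 b hb _ (by simp))

/-! ### The kernels `chi` and the functions `Wfun` -/

lemma two_pow_mul_inv_two_pow_succ (a : ℕ) : (2 : ℝ) ^ a * (2 ^ (a + 1))⁻¹ = 1 / 2 := by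
  rw [pow_succ]
  field_simp

lemma oplus_of_fract_lt {x : ℝ} (hx : 0 ≤ x) {a : ℕ} (h : Int.fract (x * 2 ^ a) < 1 / 2) :
    oplus x (a + 1) = x + (2 ^ (a + 1))⁻¹ := by
  rw [oplus, bdigit_succ hx, if_pos h, pow_zero, one_mul]

lemma oplus_of_le_fract {x : ℝ} (hx : 0 ≤ x) {a : ℕ} (h : ¬Int.fract (x * 2 ^ a) < 1 / 2) :
    oplus x (a + 1) = x - (2 ^ (a + 1))⁻¹ := by
  rw [oplus, bdigit_succ hx, if_neg h]
  ring

lemma floor_fract_add_half {x : ℝ} {a : ℕ} (h : Int.fract (x * 2 ^ a) < 1 / 2) :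
    ⌊(x + (2 ^ (a + 1))⁻¹) * 2 ^ a⌋ = ⌊x * 2 ^ a⌋ ∧
      Int.fract ((x + (2 ^ (a + 1))⁻¹) * 2 ^ a) = Int.fract (x * 2 ^ a) + 1 / 2 := by
  have h0 := Int.fract_nonneg (x * 2 ^ a)
  have hfr := Int.floor_add_fract (x * 2 ^ a)
  have h2 := two_pow_mul_inv_two_pow_succ a
  have hfl : ⌊(x + (2 ^ (a + 1))⁻¹) * 2 ^ a⌋ = ⌊x * 2 ^ a⌋ := by
    rw [Int.floor_eq_iff]
    constructor <;> linarith
  refine ⟨hfl, ?_⟩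
  rw [Int.fract, Int.fract, hfl]
  linarith

lemma floor_fract_sub_half {x : ℝ} {a : ℕ} (h : ¬Int.fract (x * 2 ^ a) < 1 / 2) :
    ⌊(x - (2 ^ (a + 1))⁻¹) * 2 ^ a⌋ = ⌊x * 2 ^ a⌋ ∧
      Int.fract ((x - (2 ^ (a + 1))⁻¹) * 2 ^ a) = Int.fract (x * 2 ^ a) - 1 / 2 := by
  have h1 := Int.fract_lt_one (x * 2 ^ a)
  have hfr := Int.floor_add_fract (x * 2 ^ a)
  have h2 := two_pow_mul_inv_two_pow_succ a
  have hfl : ⌊(x - (2 ^ (a + 1))⁻¹) * 2 ^ a⌋ = ⌊x * 2 ^ a⌋ := by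
    rw [Int.floor_eq_iff]
    constructor <;> linarith
  refine ⟨hfl, ?_⟩
  rw [Int.fract, Int.fract, hfl]
  linarith

lemma mem_Ico_zero_one_of_floor_eq {x y : ℝ} (hx : x ∈ Set.Ico (0 : ℝ) 1) {a : ℕ}
    (h : ⌊y * 2 ^ a⌋ = ⌊x * 2 ^ a⌋) : y ∈ Set.Ico (0 : ℝ) 1 := by
  have hp : (0 : ℝ) < 2 ^ a := by positivity
  have h0 : 0 ≤ ⌊y * 2 ^ a⌋ := h ▸ Int.floor_nonneg.2 (mul_nonneg hx.1 hp.le)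
  have h1 : ⌊y * 2 ^ a⌋ < 2 ^ a := by
    rw [h, Int.floor_lt]
    push_cast
    nlinarith [hx.2]
  rw [Int.floor_nonneg] at h0
  rw [Int.floor_lt] at h1
  push_cast at h1
  exact ⟨by by_contra! hy; nlinarith, by by_contra! hy; nlinarith⟩

lemma chi_of_fract_lt {x : ℝ} (hx : 0 ≤ x) {a : ℕ} (h : Int.fract (x * 2 ^ a) < 1 / 2) (y : ℝ) :
    chi (a + 1) x y = (Set.Icc x (x + (2 ^ (a + 1))⁻¹)).indicator (fun _ => 2 ^ (a + 1)) y := by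
  have : x ≤ x + (2 ^ (a + 1) : ℝ)⁻¹ := by simp
  rw [chi, oplus_of_fract_lt hx h, min_eq_left this, max_eq_right this, Set.indicator_apply]
  rfl

lemma chi_add_half {x : ℝ} (hx : 0 ≤ x) {a : ℕ} (h : Int.fract (x * 2 ^ a) < 1 / 2) (y : ℝ) :
    chi (a + 1) (x + (2 ^ (a + 1))⁻¹) y = chi (a + 1) x y := by
  have h' : ¬Int.fract ((x + (2 ^ (a + 1))⁻¹) * 2 ^ a) < 1 / 2 := by
    rw [(floor_fract_add_half h).2]
    linarith [Int.fract_nonneg (x * 2 ^ a)]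
  rw [chi, chi, oplus_of_le_fract (by positivity) h', oplus_of_fract_lt hx h,
    add_sub_cancel_right, min_comm, max_comm]

lemma floor_eq_of_chi_ne_zero {x y : ℝ} (hx : 0 ≤ x) {a : ℕ} (h : chi (a + 1) x y ≠ 0) :
    ⌊y * 2 ^ a⌋ = ⌊x * 2 ^ a⌋ := by
  have hxy : min x (oplus x (a + 1)) ≤ y ∧ y ≤ max x (oplus x (a + 1)) := by
    by_contra hn
    exact h (if_neg hn)
  have hp : (0 : ℝ) < 2 ^ a := by positivity
  have hfl : ⌊oplus x (a + 1) * 2 ^ a⌋ = ⌊x * 2 ^ a⌋ := by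
    by_cases hf : Int.fract (x * 2 ^ a) < 1 / 2
    · rw [oplus_of_fract_lt hx hf, (floor_fract_add_half hf).1]
    · rw [oplus_of_le_fract hx hf, (floor_fract_sub_half hf).1]
  have hmin : ⌊min x (oplus x (a + 1)) * 2 ^ a⌋ = ⌊x * 2 ^ a⌋ := by
    rcases min_choice x (oplus x (a + 1)) with h | h <;> rw [h]
    exact hfl
  have hmax : ⌊max x (oplus x (a + 1)) * 2 ^ a⌋ = ⌊x * 2 ^ a⌋ := by
    rcases max_choice x (oplus x (a + 1)) with h | h <;> rw [h]
    exact hfl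
  apply le_antisymm
  · rw [← hmax]
    exact Int.floor_mono (by gcongr; exact hxy.2)
  · rw [← hmin]
    exact Int.floor_mono (by gcongr; exact hxy.1)

lemma measurable_oplus (n : ℕ) : Measurable fun x => oplus x n :=
  measurable_id.add ((measurable_neg_one_pow_bdigit n).mul_const _)

lemma measurable_chi (n : ℕ) : Measurable (Function.uncurry (chi n)) := by
  have h1 : Measurable fun p : ℝ × ℝ => oplus p.1 n := (measurable_oplus n).comp measurable_fst
  exact Measurable.ite
    ((measurableSet_le (measurable_fst.min h1) measurable_snd).inter
      (measurableSet_le measurable_snd (measurable_fst.max h1)))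
    measurable_const measurable_const

lemma abs_chi_le (n : ℕ) (x y : ℝ) : |chi n x y| ≤ 2 ^ n := by
  unfold chi
  split_ifs
  · rw [abs_of_pos (by positivity)]
  · simp

lemma Wfun_zero (y : ℝ) : Wfun 0 y = 1 := by
  rw [Wfun]

lemma Wfun_add_two_pow {a m : ℕ} (h : 2 ^ (a + 1) ∣ m) (y : ℝ) :
    Wfun (m + 2 ^ a) y = ∫ x in Set.Ico (0 : ℝ) 1, chi (a + 1) x y * Wfun m x := by
  obtain ⟨c, rfl⟩ := h
  have hfac : (2 ^ (a + 1) * c + 2 ^ a).factorization 2 = a := by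
    have : 2 ^ (a + 1) * c + 2 ^ a = 2 ^ a * (2 * c + 1) := by ring
    rw [this, Nat.factorization_mul (by positivity) (by omega), Finsupp.add_apply,
      Nat.Prime.factorization_pow Nat.prime_two,
      Nat.factorization_eq_zero_of_not_dvd (n := 2 * c + 1) (by omega)]
    simp
  obtain ⟨k, hk⟩ : ∃ k, 2 ^ (a + 1) * c + 2 ^ a = k + 1 :=
    Nat.exists_eq_succ_of_ne_zero (by positivity)
  rw [hk, Wfun, ← hk, hfac, Nat.add_sub_cancel]

lemma Wfun_induction {P : ℕ → Prop} (zero : P 0)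
    (step : ∀ a m, 2 ^ (a + 1) ∣ m → P m → P (m + 2 ^ a)) (k : ℕ) : P k := by
  induction k using Nat.strong_induction_on with
  | _ k ih =>
    rcases eq_or_ne k 0 with rfl | hk
    · exact zero
    · obtain ⟨a, b, hb, rfl⟩ := Nat.exists_eq_two_pow_mul_odd hk
      obtain ⟨c, rfl⟩ := hb
      have : 2 ^ a * (2 * c + 1) = 2 ^ (a + 1) * c + 2 ^ a := by ring
      rw [this] at ih ⊢
      exact step a _ (dvd_mul_right _ _) (ih _ (by simp))

lemma measurable_Wfun (k : ℕ) : Measurable (Wfun k) := by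
  induction k using Wfun_induction with
  | zero => simpa only [funext Wfun_zero] using measurable_const
  | step a m h ih =>
    rw [funext (Wfun_add_two_pow h)]
    have hm : Measurable fun p : ℝ × ℝ => chi (a + 1) p.1 p.2 * Wfun m p.1 :=
      (measurable_chi (a + 1)).mul (ih.comp measurable_fst)
    exact (StronglyMeasurable.integral_prod_left
      (f := fun x y => chi (a + 1) x y * Wfun m x) hm.stronglyMeasurable).measurable

lemma exists_abs_Wfun_le (k : ℕ) : ∃ C, ∀ y, |Wfun k y| ≤ C := by
  induction k using Wfun_induction with
  | zero => exact ⟨1, fun y => by simp [Wfun_zero]⟩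
  | step a m h ih =>
    obtain ⟨C, hC⟩ := ih
    refine ⟨2 ^ (a + 1) * C, fun y => ?_⟩
    rw [Wfun_add_two_pow h]
    have := norm_setIntegral_le_of_norm_le_const (μ := volume) (s := Set.Ico (0 : ℝ) 1)
      (f := fun x => chi (a + 1) x y * Wfun m x) (C := 2 ^ (a + 1) * C) (by simp)
      (fun x _ => by
        rw [Real.norm_eq_abs, abs_mul]
        exact mul_le_mul (abs_chi_le _ _ _) (hC x) (abs_nonneg _) (by positivity))
    simpa using this

lemma chi_add_add {a m : ℕ} (hm : m ≤ a) {x : ℝ} (hx : 0 ≤ x) (y : ℝ) :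
    chi (a + 1) (x + (2 ^ m)⁻¹) (y + (2 ^ m)⁻¹) = chi (a + 1) x y := by
  have hfr : Int.fract ((x + (2 ^ m)⁻¹) * 2 ^ a) = Int.fract (x * 2 ^ a) := by
    have : (x + (2 ^ m)⁻¹) * 2 ^ a = x * 2 ^ a + ((2 ^ (a - m) : ℤ) : ℝ) := by
      push_cast
      rw [add_mul, pow_sub₀ _ two_ne_zero hm, mul_comm (2 ^ a : ℝ) (2 ^ m)⁻¹]
    rw [this, Int.fract_add_intCast]
  have ho : oplus (x + (2 ^ m)⁻¹) (a + 1) = oplus x (a + 1) + (2 ^ m)⁻¹ := by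
    rw [oplus, oplus, bdigit_succ hx, bdigit_succ (by positivity), hfr]
    ring
  simp only [chi, ho, min_add_add_right, max_add_add_right, add_le_add_iff_right]

lemma Wfun_add_inv_two_pow {m k : ℕ} (hk : 2 ^ m ∣ k) {y : ℝ} (h0 : 0 ≤ y)
    (h1 : y + (2 ^ m)⁻¹ < 1) : Wfun k (y + (2 ^ m)⁻¹) = Wfun k y := by
  induction k using Wfun_induction generalizing y with
  | zero => simp [Wfun_zero]
  | step a r h ih =>
    have hma : m ≤ a := by
      by_contra! hlt
      have h2 : 2 ^ (a + 1) ∣ r + 2 ^ a := (pow_dvd_pow 2 hlt).trans hk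
      have h3 := Nat.le_of_dvd (by positivity) ((Nat.dvd_add_right h).1 h2)
      rw [pow_succ] at h3
      have := Nat.two_pow_pos a
      omega
    have hr : 2 ^ m ∣ r := (pow_dvd_pow 2 (by omega)).trans h
    set δ : ℝ := (2 ^ m)⁻¹ with hδ
    have hδ0 : 0 < δ := by positivity
    have hδa : δ * 2 ^ a = ((2 ^ (a - m) : ℤ) : ℝ) := by
      push_cast
      rw [hδ, pow_sub₀ _ two_ne_zero hma, mul_comm]
    have hp : (0 : ℝ) < 2 ^ a := by positivity
    have hone : (1 : ℝ) * 2 ^ a = ((2 ^ a : ℤ) : ℝ) := by push_cast; ring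
    rw [Wfun_add_two_pow h, Wfun_add_two_pow h]
    have e1 : ∫ x in Set.Ico (0 : ℝ) 1, chi (a + 1) x (y + δ) * Wfun r x
        = ∫ x in Set.Ico δ 1, chi (a + 1) x (y + δ) * Wfun r x := by
      refine setIntegral_eq_of_subset_of_forall_sdiff_eq_zero measurableSet_Ico
        (Set.Ico_subset_Ico_left hδ0.le) fun x hx => ?_
      have hxδ : x < δ := by
        by_contra! hle
        exact hx.2 ⟨hle, hx.1.2⟩
      by_contra hne
      have hfl := floor_eq_of_chi_ne_zero hx.1.1 (left_ne_zero_of_mul hne)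
      have hlt : ⌊x * 2 ^ a⌋ < 2 ^ (a - m) := by
        rw [Int.floor_lt, ← hδa]
        gcongr
      have hge : 2 ^ (a - m) ≤ ⌊(y + δ) * 2 ^ a⌋ := by
        rw [Int.le_floor, ← hδa]
        gcongr
        linarith
      omega
    have e2 : ∫ x in Set.Ico (0 : ℝ) 1, chi (a + 1) x y * Wfun r x
        = ∫ x in Set.Ico 0 (1 - δ), chi (a + 1) x y * Wfun r x := by
      refine setIntegral_eq_of_subset_of_forall_sdiff_eq_zero measurableSet_Ico
        (Set.Ico_subset_Ico_right (by linarith)) fun x hx => ?_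
      have hxδ : 1 - δ ≤ x := by
        by_contra! hle
        exact hx.2 ⟨hx.1.1, hle⟩
      by_contra hne
      have hfl := floor_eq_of_chi_ne_zero hx.1.1 (left_ne_zero_of_mul hne)
      have hge : 2 ^ a - 2 ^ (a - m) ≤ ⌊x * 2 ^ a⌋ := by
        rw [Int.le_floor, Int.cast_sub, ← hδa, ← hone, ← sub_mul]
        gcongr
      have hlt : ⌊y * 2 ^ a⌋ < 2 ^ a - 2 ^ (a - m) := by
        rw [Int.floor_lt, Int.cast_sub, ← hδa, ← hone, ← sub_mul]
        gcongr
        linarith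
      omega
    have e3 := (measurePreserving_add_right volume δ).setIntegral_preimage_emb
      (measurableEmbedding_addRight δ) (fun x => chi (a + 1) x (y + δ) * Wfun r x) (Set.Ico δ 1)
    rw [Set.preimage_add_const_Ico, sub_self] at e3
    rw [e1, e2, ← e3]
    refine setIntegral_congr_fun measurableSet_Ico fun x hx => ?_
    rw [chi_add_add hma hx.1, ih hr hx.1 (by linarith [hx.2])]

/-! ### The one-dimensional integration by parts -/

/-- The points of `[0,1)` whose binary digit of index `a + 1` vanishes, that is, the union of the
left halves of the dyadic intervals of length `2^{-a}`. -/
def leftHalves (a : ℕ) : Set ℝ := Set.Ico 0 1 ∩ {x | Int.fract (x * 2 ^ a) < 1 / 2}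

lemma measurableSet_leftHalves (a : ℕ) : MeasurableSet (leftHalves a) :=
  measurableSet_Ico.inter
    (measurableSet_lt (measurable_fract.comp (measurable_id.mul_const _)) measurable_const)

lemma add_half_mem_Ico {a : ℕ} {x : ℝ} (hx : x ∈ leftHalves a) :
    x + (2 ^ (a + 1))⁻¹ ∈ Set.Ico (0 : ℝ) 1 :=
  mem_Ico_zero_one_of_floor_eq hx.1 (floor_fract_add_half hx.2).1

lemma preimage_add_half (a : ℕ) :
    (fun x : ℝ => x + (2 ^ (a + 1))⁻¹) ⁻¹' (Set.Ico 0 1 \ leftHalves a) = leftHalves a := by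
  ext x
  constructor
  · rintro ⟨h1, h2⟩
    have hf : ¬Int.fract ((x + (2 ^ (a + 1))⁻¹) * 2 ^ a) < 1 / 2 := fun h => h2 ⟨h1, h⟩
    obtain ⟨h3, h4⟩ := floor_fract_sub_half hf
    rw [add_sub_cancel_right] at h3 h4
    refine ⟨mem_Ico_zero_one_of_floor_eq h1 h3, ?_⟩
    rw [Set.mem_ofPred_eq, h4]
    linarith [Int.fract_lt_one ((x + (2 ^ (a + 1))⁻¹) * 2 ^ a)]
  · intro hx
    refine ⟨add_half_mem_Ico hx, fun h => ?_⟩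
    have := h.2
    rw [Set.mem_ofPred_eq, (floor_fract_add_half hx.2).2] at this
    linarith [Int.fract_nonneg (x * 2 ^ a)]

lemma setIntegral_Ico_eq_leftHalves (a : ℕ) {F : ℝ → ℝ} (hF : IntegrableOn F (Set.Ico 0 1)) :
    ∫ x in Set.Ico (0 : ℝ) 1, F x = ∫ x in leftHalves a, (F x + F (x + (2 ^ (a + 1))⁻¹)) := by
  have hsub : leftHalves a ⊆ Set.Ico 0 1 := Set.inter_subset_left
  have hmp := measurePreserving_add_right volume ((2 ^ (a + 1) : ℝ)⁻¹)
  have he := measurableEmbedding_addRight ((2 ^ (a + 1) : ℝ)⁻¹)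
  have h1 := hmp.setIntegral_preimage_emb he F (Set.Ico 0 1 \ leftHalves a)
  have h2 := (hmp.integrableOn_comp_preimage he).2 (hF.mono_set Set.sdiff_subset :
    IntegrableOn F (Set.Ico 0 1 \ leftHalves a))
  rw [preimage_add_half] at h1 h2
  have h3 := integral_add (hF.mono_set hsub) h2
  simp only [Function.comp_apply] at h3
  rw [h3, h1, ← setIntegral_union Set.disjoint_sdiff_right
    (measurableSet_Ico.diff (measurableSet_leftHalves a)) (hF.mono_set hsub)
    (hF.mono_set Set.sdiff_subset), Set.union_sdiff_cancel hsub]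

lemma setIntegral_chi_mul_deriv {a : ℕ} {x : ℝ} (hx : x ∈ leftHalves a) {g g' : ℝ → ℝ}
    (hg : ContinuousOn g' (Set.Icc 0 1))
    (hd : ∀ t ∈ Set.Icc (0 : ℝ) 1, HasDerivWithinAt g (g' t) (Set.Icc 0 1) t) :
    ∫ y in Set.Ico (0 : ℝ) 1, chi (a + 1) x y * g' y
      = 2 ^ (a + 1) * (g (x + (2 ^ (a + 1))⁻¹) - g x) := by
  set δ : ℝ := (2 ^ (a + 1))⁻¹ with hδ
  have hδ0 : 0 < δ := by positivity
  have hxδ : x + δ < 1 := (add_half_mem_Ico hx).2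
  have hsub : Set.Icc x (x + δ) ⊆ Set.Icc 0 1 := Set.Icc_subset_Icc hx.1.1 hxδ.le
  have hftc : ∫ y in x..(x + δ), g' y = g (x + δ) - g x := by
    refine intervalIntegral.integral_eq_sub_of_hasDerivAt_of_le (by linarith)
      (fun t ht => ((hd t (hsub ht)).continuousWithinAt).mono hsub) (fun t ht => ?_) ?_
    · exact (hd t (hsub (Set.Ioo_subset_Icc_self ht))).hasDerivAt
        (Icc_mem_nhds (by linarith [hx.1.1, ht.1]) (by linarith [ht.2]))
    · exact (hg.mono (by rwa [Set.uIcc_of_le (by linarith)])).intervalIntegrable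
  have hfun : (fun y => chi (a + 1) x y * g' y)
      = (Set.Icc x (x + δ)).indicator fun y => 2 ^ (a + 1) * g' y := by
    ext y
    rw [chi_of_fract_lt hx.1.1 hx.2]
    by_cases hy : y ∈ Set.Icc x (x + δ) <;> simp [← hδ, hy]
  have hinter : Set.Ico 0 1 ∩ Set.Icc x (x + δ) = Set.Icc x (x + δ) :=
    Set.inter_eq_right.2 fun y hy => ⟨hx.1.1.trans hy.1, hy.2.trans_lt hxδ⟩
  rw [hfun, setIntegral_indicator measurableSet_Icc, hinter, integral_const_mul,
    integral_Icc_eq_integral_Ioc, ← intervalIntegral.integral_of_le (by linarith), hftc]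

lemma setIntegral_mul_digit_eq {a : ℕ} {g g' w v : ℝ → ℝ}
    (hg : ContinuousOn g' (Set.Icc 0 1))
    (hd : ∀ t ∈ Set.Icc (0 : ℝ) 1, HasDerivWithinAt g (g' t) (Set.Icc 0 1) t)
    (hwm : Measurable w) {C : ℝ} (hwC : ∀ x, |w x| ≤ C)
    (hw : ∀ x, 0 ≤ x → x + (2 ^ (a + 1))⁻¹ < 1 → w (x + (2 ^ (a + 1))⁻¹) = w x)
    (hvm : Measurable v) {E : ℝ} (hvE : ∀ x, |v x| ≤ E)
    (hv : ∀ x y, ⌊x * 2 ^ a⌋ = ⌊y * 2 ^ a⌋ → v x = v y) :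
    ∫ x in Set.Ico (0 : ℝ) 1, g x * (w x * ((-1) ^ bdigit x (a + 1) * v x))
      = -(2 ^ (a + 2))⁻¹ * ∫ y in Set.Ico (0 : ℝ) 1,
          g' y * ((∫ x in Set.Ico (0 : ℝ) 1, chi (a + 1) x y * w x) * v y) := by
  have hgi : IntegrableOn g (Set.Ico 0 1) :=
    (ContinuousOn.integrableOn_compact isCompact_Icc
      fun t ht => (hd t ht).continuousWithinAt).mono_set Set.Ico_subset_Icc_self
  have hgi' : IntegrableOn g' (Set.Ico 0 1) :=
    (hg.integrableOn_compact isCompact_Icc).mono_set Set.Ico_subset_Icc_self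
  have hC : 0 ≤ C := (abs_nonneg _).trans (hwC 0)
  have hE : 0 ≤ E := (abs_nonneg _).trans (hvE 0)
  have hleft : ∫ x in Set.Ico (0 : ℝ) 1, g x * (w x * ((-1) ^ bdigit x (a + 1) * v x))
      = ∫ x in leftHalves a, -(2 ^ (a + 1))⁻¹ *
          ∫ y in Set.Ico (0 : ℝ) 1, w x * v x * (chi (a + 1) x y * g' y) := by
    rw [setIntegral_Ico_eq_leftHalves a]
    · refine setIntegral_congr_fun (measurableSet_leftHalves a) fun x hx => ?_
      have hδ := add_half_mem_Ico hx
      have hf := floor_fract_add_half hx.2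
      have hb : bdigit x (a + 1) = 0 := by rw [bdigit_succ hx.1.1, if_pos (show Int.fract (x * 2 ^ a) < 1 / 2 from hx.2)]
      have hb' : bdigit (x + (2 ^ (a + 1))⁻¹) (a + 1) = 1 := by
        rw [bdigit_succ hδ.1, if_neg]
        linarith [hf.2, Int.fract_nonneg (x * 2 ^ a)]
      simp only [integral_const_mul]
      rw [setIntegral_chi_mul_deriv hx hg hd, hw x hx.1.1 hδ.2, hv _ _ hf.1, hb, hb']
      field_simp
      ring
    · refine hgi.mul_bdd (c := C * E) ?_ (Filter.Eventually.of_forall fun x => ?_)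
      · exact (hwm.mul ((measurable_neg_one_pow_bdigit _).mul hvm)).aestronglyMeasurable
      · rw [Real.norm_eq_abs, abs_mul, abs_mul, abs_pow, abs_neg, abs_one, one_pow, one_mul]
        exact mul_le_mul (hwC x) (hvE x) (abs_nonneg _) hC
  have hinner (y : ℝ) : ∫ x in Set.Ico (0 : ℝ) 1, chi (a + 1) x y * w x
      = ∫ x in leftHalves a, 2 * (chi (a + 1) x y * w x) := by
    rw [setIntegral_Ico_eq_leftHalves a]
    · refine setIntegral_congr_fun (measurableSet_leftHalves a) fun x hx => ?_
      rw [chi_add_half hx.1.1 hx.2, hw x hx.1.1 (add_half_mem_Ico hx).2]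
      ring
    · refine Measure.integrableOn_of_bounded (M := 2 ^ (a + 1) * C) (by simp) ?_
        (Filter.Eventually.of_forall fun x => ?_)
      · exact (((measurable_chi (a + 1)).comp (measurable_id.prodMk measurable_const)).mul
          hwm).aestronglyMeasurable
      · rw [Real.norm_eq_abs, abs_mul]
        exact mul_le_mul (abs_chi_le _ _ _) (hwC x) (abs_nonneg _) (by positivity)
  have hlocal (x : ℝ) (hx : x ∈ leftHalves a) (y : ℝ) :
      g' y * v y * (2 * (chi (a + 1) x y * w x))
        = 2 * (w x * v x * (chi (a + 1) x y * g' y)) := by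
    by_cases h : chi (a + 1) x y = 0
    · simp [h]
    · rw [hv _ _ (floor_eq_of_chi_ne_zero hx.1.1 h)]
      ring
  have hint : Integrable
      (Function.uncurry fun x y => w x * v x * (chi (a + 1) x y * g' y))
      ((volume.restrict (leftHalves a)).prod (volume.restrict (Set.Ico (0 : ℝ) 1))) := by
    have hwv : IntegrableOn (fun x => w x * v x) (leftHalves a) := by
      refine Measure.integrableOn_of_bounded (M := C * E) ?_ (hwm.mul hvm).aestronglyMeasurable
        (Filter.Eventually.of_forall fun x => ?_)
      · exact measure_ne_top_of_subset (Set.inter_subset_left) (by simp)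
      · rw [Real.norm_eq_abs, abs_mul]
        exact mul_le_mul (hwC x) (hvE x) (abs_nonneg _) hC
    refine ((hwv.mul_prod hgi').bdd_mul (f := Function.uncurry (chi (a + 1)))
      (c := 2 ^ (a + 1)) (measurable_chi _).aestronglyMeasurable
      (Filter.Eventually.of_forall fun p => abs_chi_le _ _ _)).congr
      (Filter.Eventually.of_forall fun p => ?_)
    simp only [Function.uncurry]
    ring
  have hright : ∫ y in Set.Ico (0 : ℝ) 1,
        g' y * ((∫ x in Set.Ico (0 : ℝ) 1, chi (a + 1) x y * w x) * v y)
      = 2 * ∫ x in leftHalves a, ∫ y in Set.Ico (0 : ℝ) 1,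
          w x * v x * (chi (a + 1) x y * g' y) := by
    rw [integral_integral_swap hint, ← integral_const_mul]
    refine integral_congr_ae (Filter.Eventually.of_forall fun y => ?_)
    simp only
    rw [hinner, mul_comm _ (v y), ← mul_assoc, ← integral_const_mul, ← integral_const_mul]
    exact setIntegral_congr_fun (measurableSet_leftHalves a) fun x hx => hlocal x hx y
  rw [hleft, hright, integral_const_mul, pow_succ 2 (a + 1)]
  field_simp

/-! ### Slicing the unit cube along one coordinate -/

lemma setIntegral_unitCube_eq_insertNth {n : ℕ} (i : Fin (n + 1)) {F : (Fin (n + 1) → ℝ) → ℝ}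
    (hF : IntegrableOn F (unitCube (n + 1))) :
    ∫ x in unitCube (n + 1), F x
      = ∫ y in unitCube n, ∫ t in Set.Ico (0 : ℝ) 1, F (i.insertNth t y) := by
  set e := (MeasurableEquiv.piFinSuccAbove (fun _ : Fin (n + 1) => ℝ) i).symm
  have hmp : MeasurePreserving e :=
    (volume_preserving_piFinSuccAbove (fun _ : Fin (n + 1) => ℝ) i).symm
  have hpre : e ⁻¹' unitCube (n + 1) = Set.Ico (0 : ℝ) 1 ×ˢ unitCube n := by
    ext ⟨t, y⟩
    have het : e (t, y) = i.insertNth t y := rfl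
    simp only [unitCube, Set.mem_preimage, Set.mem_univ_pi, Set.mem_prod, het]
    rw [Fin.forall_iff_succAbove i]
    simp
  have h1 := hmp.setIntegral_preimage_emb e.measurableEmbedding F (unitCube (n + 1))
  have h2 := (hmp.integrableOn_comp_preimage e.measurableEmbedding).2 hF
  rw [hpre, Measure.volume_eq_prod] at h1
  rw [hpre, IntegrableOn, Measure.volume_eq_prod, ← Measure.prod_restrict] at h2
  rw [← h1, ← Measure.prod_restrict]
  exact integral_prod_symm _ h2

lemma measurableSet_unitCube (s : ℕ) : MeasurableSet (unitCube s) :=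
  MeasurableSet.univ_pi fun _ => measurableSet_Ico

lemma unitCube_subset_closedCube (s : ℕ) : unitCube s ⊆ closedCube s :=
  Set.pi_mono fun _ _ => Set.Ico_subset_Icc_self

lemma setIntegral_unitCube_eq_mul_of_slices {s : ℕ} (i : Fin s) {F G : (Fin s → ℝ) → ℝ}
    (hF : IntegrableOn F (unitCube s)) (hG : IntegrableOn G (unitCube s)) (c : ℝ)
    (h : ∀ x ∈ unitCube s, ∫ t in Set.Ico (0 : ℝ) 1, F (Function.update x i t)
      = c * ∫ t in Set.Ico (0 : ℝ) 1, G (Function.update x i t)) :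
    ∫ x in unitCube s, F x = c * ∫ x in unitCube s, G x := by
  obtain ⟨n, rfl⟩ : ∃ n, s = n + 1 := Nat.exists_eq_succ_of_ne_zero (by have := i.2; omega)
  rw [setIntegral_unitCube_eq_insertNth i hF, setIntegral_unitCube_eq_insertNth i hG,
    ← integral_const_mul]
  refine setIntegral_congr_fun (measurableSet_unitCube n) fun y hy => ?_
  have := h (i.insertNth 0 y) fun j _ => by
    revert j
    rw [Fin.forall_iff_succAbove i]
    simpa using fun j => hy j trivial
  simpa only [Fin.update_insertNth] using this

/-! ### Integration by parts in one variable of the cube -/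

/-- The factor in the variable `t` which remains after the `n` most significant binary digits of
`k` have been treated. -/
def partialKernel (n k : ℕ) (t : ℝ) : ℝ := Wfun (kLe n k) t * walsh (kGt n k) t

lemma measurable_partialKernel (n k : ℕ) : Measurable (partialKernel n k) :=
  (measurable_Wfun _).mul (measurable_walsh _)

lemma exists_abs_partialKernel_le (n k : ℕ) : ∃ C, ∀ t, |partialKernel n k t| ≤ C := by
  obtain ⟨C, hC⟩ := exists_abs_Wfun_le (kLe n k)
  exact ⟨C, fun t => by simpa [partialKernel, abs_mul, abs_walsh] using hC t⟩

lemma setIntegral_mul_partialKernel {n k : ℕ} (hn : n < (bitsDesc k).length) {g g' : ℝ → ℝ}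
    (hg : ContinuousOn g' (Set.Icc 0 1))
    (hd : ∀ t ∈ Set.Icc (0 : ℝ) 1, HasDerivWithinAt g (g' t) (Set.Icc 0 1) t) :
    ∫ t in Set.Ico (0 : ℝ) 1, g t * partialKernel n k t
      = -(2 ^ ((bitsDesc k)[n] + 2))⁻¹ *
          ∫ t in Set.Ico (0 : ℝ) 1, g' t * partialKernel (n + 1) k t := by
  obtain ⟨C, hC⟩ := exists_abs_Wfun_le (kLe n k)
  have hdvd := two_pow_succ_dvd_kLe hn
  have hlt := kGt_succ_lt hn
  simp only [partialKernel, kGt_eq hn, kLe_succ hn, walsh_two_pow_add hlt, Wfun_add_two_pow hdvd]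
  exact setIntegral_mul_digit_eq hg hd (measurable_Wfun _) hC
    (fun x h0 h1 => Wfun_add_inv_two_pow hdvd h0 h1) (measurable_walsh _)
    (fun x => (abs_walsh _ x).le) fun x y => walsh_congr hlt

lemma integrableOn_mul_prod_partialKernel {s : ℕ} {g : (Fin s → ℝ) → ℝ}
    (hg : ContinuousOn g (closedCube s)) (ν k : Fin s → ℕ) :
    IntegrableOn (fun x => g x * ∏ j, partialKernel (ν j) (k j) (x j)) (unitCube s) := by
  choose C hC using fun j => exists_abs_partialKernel_le (ν j) (k j)
  have hgi : IntegrableOn g (unitCube s) :=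
    (hg.integrableOn_compact (isCompact_univ_pi fun _ => isCompact_Icc)).mono_set
      (unitCube_subset_closedCube s)
  refine hgi.mul_bdd (c := ∏ j, C j) ?_ (Filter.Eventually.of_forall fun x => ?_)
  · exact (Finset.measurable_prod _ fun j _ =>
      (measurable_partialKernel (ν j) (k j)).comp (measurable_pi_apply j)).aestronglyMeasurable
  · rw [Real.norm_eq_abs, Finset.abs_prod]
    exact Finset.prod_le_prod (fun _ _ => abs_nonneg _) fun j _ => hC j _

lemma setIntegral_mixedDeriv_addE {s : ℕ} {u : Fin s → ℕ} {f : (Fin s → ℝ) → ℝ}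
    {D : (Fin s → ℕ) → (Fin s → ℝ) → ℝ} (hf : HasMixedDerivs u f D) (k : Fin s → ℕ)
    (ν : Fin s → ℕ) (i : Fin s) (hν : ∀ j, addE i ν j ≤ u j) (hi : ν i < (bitsDesc (k i)).length) :
    ∫ x in unitCube s, D ν x * ∏ j, partialKernel (ν j) (k j) (x j)
      = -(2 ^ ((bitsDesc (k i))[ν i] + 2))⁻¹ *
          ∫ x in unitCube s, D (addE i ν) x * ∏ j, partialKernel (addE i ν j) (k j) (x j) := by
  have hνu (j : Fin s) : ν j ≤ u j := by
    refine le_trans ?_ (hν j)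
    rcases eq_or_ne j i with rfl | hj <;> simp [addE, *]
  refine setIntegral_unitCube_eq_mul_of_slices i
    (integrableOn_mul_prod_partialKernel (hf.2.1 ν hνu) ν k)
    (integrableOn_mul_prod_partialKernel (hf.2.1 _ hν) _ k) _ fun x hx => ?_
  have hmem (t : ℝ) (ht : t ∈ Set.Icc (0 : ℝ) 1) : Function.update x i t ∈ closedCube s :=
    (Set.update_mem_pi_iff_of_mem (unitCube_subset_closedCube s hx)).2 fun _ => ht
  have hprod (μ : Fin s → ℕ) (t : ℝ) :
      ∏ j, partialKernel (μ j) (k j) (Function.update x i t j)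
        = partialKernel (μ i) (k i) t *
          ∏ j ∈ univ.erase i, partialKernel (μ j) (k j) (x j) := by
    rw [← Finset.mul_prod_erase univ _ (Finset.mem_univ i), Function.update_self]
    congr 1
    refine Finset.prod_congr rfl fun j hj => ?_
    rw [Function.update_of_ne (Finset.ne_of_mem_erase hj)]
  have hrest : ∏ j ∈ univ.erase i, partialKernel (addE i ν j) (k j) (x j)
      = ∏ j ∈ univ.erase i, partialKernel (ν j) (k j) (x j) :=
    Finset.prod_congr rfl fun j hj => by
      rw [addE, Function.update_of_ne (Finset.ne_of_mem_erase hj)]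
  simp only [hprod, hrest, ← mul_assoc, integral_mul_const]
  congr 1
  have hself : addE i ν i = ν i + 1 := by simp [addE]
  rw [hself]
  refine setIntegral_mul_partialKernel hi ?_ fun t ht => ?_
  · exact (hf.2.1 _ hν).comp ((continuous_const (y := x)).update i continuous_id).continuousOn hmem
  · simpa using hf.2.2 ν i hν _ (hmem t ht)

lemma walshCoeff_eq_setIntegral_mixedDeriv {s : ℕ} {u : Fin s → ℕ} {f : (Fin s → ℝ) → ℝ}
    {D : (Fin s → ℕ) → (Fin s → ℝ) → ℝ} (hf : HasMixedDerivs u f D) (k ν : Fin s → ℕ)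
    (hνu : ∀ i, ν i ≤ u i) (hνk : ∀ i, ν i ≤ (bitsDesc (k i)).length) :
    walshCoeff f k = (-1) ^ (∑ i, ν i) * (2 ^ ∑ i, muW (ν i) (k i))⁻¹ *
      ∫ x in unitCube s, D ν x * ∏ j, partialKernel (ν j) (k j) (x j) := by
  induction hN : ∑ i, ν i generalizing ν with
  | zero =>
    obtain rfl : ν = fun _ => 0 := by
      ext i
      exact (Finset.sum_eq_zero_iff.1 hN) i (Finset.mem_univ i)
    simp [walshCoeff, walshV, partialKernel, hf.1, muW_zero, kLe_zero, kGt_zero, Wfun_zero]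
  | succ N ih =>
    obtain ⟨i, -, hi⟩ : ∃ i ∈ univ, ν i ≠ 0 := by
      by_contra! h
      rw [Finset.sum_eq_zero h] at hN
      omega
    obtain ⟨μ, rfl⟩ : ∃ μ, ν = addE i μ := by
      refine ⟨Function.update ν i (ν i - 1), ?_⟩
      rw [addE, Function.update_self, Function.update_idem, Nat.sub_add_cancel (by omega),
        Function.update_eq_self]
    have hself : addE i μ i = μ i + 1 := by simp [addE]
    have hne {j : Fin s} (hj : j ∈ univ.erase i) : addE i μ j = μ j := by
      rw [addE, Function.update_of_ne (Finset.ne_of_mem_erase hj)]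
    have hle (j : Fin s) : μ j ≤ addE i μ j := by
      rcases eq_or_ne j i with rfl | hj <;> simp [addE, *]
    have hlt : μ i < (bitsDesc (k i)).length := by
      have := hνk i
      omega
    have hsum : ∑ j, μ j = N := by
      rw [← Finset.add_sum_erase _ _ (Finset.mem_univ i), hself,
        Finset.sum_congr rfl fun j hj => hne hj] at hN
      rw [← Finset.add_sum_erase _ _ (Finset.mem_univ i)]
      omega
    have hmu : ∑ j, muW (addE i μ j) (k j)
        = (∑ j, muW (μ j) (k j)) + ((bitsDesc (k i))[μ i] + 2) := by
      rw [← Finset.add_sum_erase _ _ (Finset.mem_univ i), hself,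
        ← Finset.add_sum_erase _ (fun j => muW (μ j) (k j)) (Finset.mem_univ i),
        Finset.sum_congr rfl fun j hj => by rw [hne hj], muW_succ hlt]
      ring
    rw [ih μ (fun j => (hle j).trans (hνu j)) (fun j => (hle j).trans (hνk j)) hsum,
      setIntegral_mixedDeriv_addE hf k μ i hνu hlt, hmu, pow_add, mul_inv, pow_succ]
    ring

/-- Lemma `conti_id`: for `u ∈ ℕ^s` and `f` with continuous mixed
partial derivatives up to order `u_i` in each variable,
`f̂(k) = (-1)^{∑ᵢ min(u_i,N_i)} 2^{-μ'_u(k)}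
  ∫ f^{(min(u,N_k))}(x) ⋅ ∏ᵢ W(k_{i,≤}^{u_i})(x_i) ⋅ wal_{k^u_>}(x) dx`. -/
theorem stmt5 {s : ℕ} (hs : 1 ≤ s) (u : Fin s → ℕ) (hu : ∀ i, 1 ≤ u i)
    (f : (Fin s → ℝ) → ℝ) (D : (Fin s → ℕ) → (Fin s → ℝ) → ℝ)
    (hf : HasMixedDerivs u f D) (k : Fin s → ℕ) :
    walshCoeff f k =
      (-1 : ℝ) ^ (∑ i, min (u i) (numBits (k i))) * ((2 : ℝ) ^ muWV u k)⁻¹ *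
        ∫ x in unitCube s,
          D (fun i => min (u i) (numBits (k i))) x *
            (∏ i, Wfun (kLe (u i) (k i)) (x i)) *
            walshV (fun i => kGt (u i) (k i)) x := by
  rw [walshCoeff_eq_setIntegral_mixedDeriv hf k (fun i => min (u i) (numBits (k i)))
    (fun i => min_le_left _ _) fun i => min_le_right _ _]
  have hmin (i : Fin s) : muW (min (u i) (numBits (k i))) (k i) = muW (u i) (k i) ∧
      kLe (min (u i) (numBits (k i))) (k i) = kLe (u i) (k i) ∧
      kGt (min (u i) (numBits (k i))) (k i) = kGt (u i) (k i) := by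
    rcases le_total (u i) (numBits (k i)) with h | h
    · simp [min_eq_left h]
    · rw [min_eq_right h]
      simp only [muW, kLe, kGt, numBits, List.take_length, List.drop_length,
        List.take_of_length_le h, List.drop_of_length_le h, and_self]
  simp only [partialKernel, Finset.prod_mul_distrib, hmin, muWV, walshV, mul_assoc]

end
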